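/- Let a₁, r ∈ ℝ with a₁ > 0 and r > 0, and let aₙ = a₁ · r^(n−1). Let i, j, k be positive integers and let t₁, t₂, n₁, n₂ be positive integers and t a rational number such that t₁/n₁ + t₂/n₂ = t and (t₁/n₁)·i + (t₂/n₂)·j = t·k. Then (aᵢ)^(t₁/n₁) · (aⱼ)^(t₂/n₂) = (aₖ)^t, where the powers are real powers with rational exponents. -/

import Mathlib

/-- Corollary 2.5: if `t₁/n₁ + t₂/n₂ = t` and `(t₁/n₁)·i + (t₂/n₂)·j = t·k`,
then `(aᵢ)^(t₁/n₁) * (aⱼ)^(t₂/n₂) = (aₖ)^t` for a positive geometric sequence. -/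
theorem rat_power_identity (a₁ r : ℝ) (ha : 0 < a₁) (hr : 0 < r)
    (i j k : ℕ) (hi : 0 < i) (hj : 0 < j) (hk : 0 < k)
    (t₁ t₂ n₁ n₂ : ℕ) (ht₁ : 0 < t₁) (ht₂ : 0 < t₂) (hn₁ : 0 < n₁) (hn₂ : 0 < n₂)
    (t : ℚ)
    (hsum : (t₁ : ℚ) / n₁ + (t₂ : ℚ) / n₂ = t)
    (hwsum : (t₁ : ℚ) / n₁ * i + (t₂ : ℚ) / n₂ * j = t * k) :
    (a₁ * r ^ (i - 1)) ^ (((t₁ : ℚ) / n₁ : ℚ) : ℝ)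
      * (a₁ * r ^ (j - 1)) ^ (((t₂ : ℚ) / n₂ : ℚ) : ℝ)
      = (a₁ * r ^ (k - 1)) ^ ((t : ℚ) : ℝ) := by
  generalize (t₁ : ℚ) / n₁ = p at *
  generalize (t₂ : ℚ) / n₂ = q at *
  obtain ⟨i, rfl⟩ := Nat.exists_eq_succ_of_ne_zero hi.ne'
  obtain ⟨j, rfl⟩ := Nat.exists_eq_succ_of_ne_zero hj.ne'
  obtain ⟨k, rfl⟩ := Nat.exists_eq_succ_of_ne_zero hk.ne'
  have h1 : (p : ℝ) + q = t := by exact_mod_cast hsum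
  have h2 : (p : ℝ) * (i + 1) + q * (j + 1) = t * (k + 1) := by exact_mod_cast hwsum
  have key : ∀ (m : ℕ) (x : ℝ),
      (a₁ * r ^ (m.succ - 1)) ^ x = Real.exp (x * (Real.log a₁ + m * Real.log r)) := by
    intro m x
    have hm : 0 < r ^ m := pow_pos hr m
    rw [Nat.succ_sub_one, Real.rpow_def_of_pos (mul_pos ha hm),
      Real.log_mul ha.ne' hm.ne', Real.log_pow, mul_comm]
  rw [key, key, key, ← Real.exp_add]
  congr 1
  linear_combination (Real.log a₁ - Real.log r) * h1 + Real.log r * h2
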